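/- In the Fibonacci-run graph R_{21}, the vertices β = 100110001110000011100 and γ = 111111111110000000000 satisfy H(β, γ) = 8 and d_{R_{21}}(β, γ) = 14. -/

import Mathlib

/-- Run-constrained binary strings: every maximal run of `1`s is immediately
followed by a strictly longer run of `0`s. -/
inductive RunConstrained : List Bool → Prop
  | nil : RunConstrained []
  | zero {l : List Bool} : RunConstrained l → RunConstrained (false :: l)
  | block {l : List Bool} (r s : ℕ) (hr : 1 ≤ r) (hs : r < s) :
      RunConstrained l →
      RunConstrained (List.replicate r true ++ List.replicate s false ++ l)

/-- Hamming distance between two binary strings (of the same length). -/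
def hammingD (α β : List Bool) : ℕ := (List.zipWith bne α β).count true

/-- The Fibonacci-run graph `R n`: vertices are strings `r` of length `n` with
`r00` run-constrained; two vertices are adjacent iff they differ in exactly one
coordinate. -/
noncomputable def fibRunGraph (n : ℕ) :
    SimpleGraph {l : List Bool // l.length = n ∧ RunConstrained (l ++ [false, false])} :=
  SimpleGraph.fromRel fun a b => hammingD a.1 b.1 = 1

/-- Scanner for run-constrained strings: `p` is the length of the current run of `1`s and `d` the
number of `0`s still required after the last completed run of `1`s. -/
def runCheck : List Bool → ℕ → ℕ → Bool
  | [], p, d => p == 0 && d == 0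
  | true :: l, p, d => d == 0 && runCheck l (p + 1) 0
  | false :: l, p, d => runCheck l 0 (p + (d - 1))

theorem runCheck_replicate_true (r : ℕ) (l : List Bool) (p : ℕ) :
    runCheck (List.replicate r true ++ l) p 0 = runCheck l (p + r) 0 := by
  induction r generalizing p with
  | zero => rfl
  | succ r ih => simp [List.replicate_succ, runCheck, ih, Nat.add_assoc, Nat.add_comm 1 r]

theorem runCheck_replicate_false {s d : ℕ} (l : List Bool) (h : d ≤ s) :
    runCheck (List.replicate s false ++ l) 0 d = runCheck l 0 0 := by
  induction s generalizing d with
  | zero => simp [Nat.le_zero.mp h]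
  | succ s ih => simp [List.replicate_succ, runCheck, ih (show d - 1 ≤ s by omega)]

theorem RunConstrained.runCheck {l : List Bool} (h : RunConstrained l) :
    runCheck l 0 0 = true := by
  induction h with
  | nil => rfl
  | zero _ ih => exact ih
  | block r s hr hs _ ih =>
    obtain ⟨s, rfl⟩ : ∃ t, s = t + 1 := ⟨s - 1, by omega⟩
    rw [List.append_assoc, runCheck_replicate_true, List.replicate_succ, List.cons_append,
      _root_.runCheck, runCheck_replicate_false _ (by omega), ih]

theorem runConstrained_of_runCheck_aux (l : List Bool) :
    (∀ d, runCheck l 0 d = true → ∃ m, l = List.replicate d false ++ m ∧ RunConstrained m) ∧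
      ∀ p, 1 ≤ p → runCheck l p 0 = true → RunConstrained (List.replicate p true ++ l) := by
  induction l with
  | nil =>
    refine ⟨fun d h => ⟨[], ?_, .nil⟩, fun p hp h => ?_⟩
    · have : d = 0 := by simpa [runCheck] using h
      simp [this]
    · have : p = 0 := by simpa [runCheck] using h
      omega
  | cons x l ih =>
    obtain ⟨ih₁, ih₂⟩ := ih
    cases x with
    | true =>
      refine ⟨fun d h => ?_, fun p hp h => ?_⟩
      · obtain ⟨rfl, h⟩ : d = 0 ∧ runCheck l 1 0 = true := by simpa [runCheck] using h
        exact ⟨true :: l, rfl, ih₂ 1 le_rfl h⟩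
      · have h : runCheck l (p + 1) 0 = true := by simpa [runCheck] using h
        simpa [List.replicate_succ'] using ih₂ (p + 1) (by omega) h
    | false =>
      refine ⟨fun d h => ?_, fun p hp h => ?_⟩
      · cases d with
        | zero =>
          obtain ⟨m, rfl, hm⟩ := ih₁ 0 h
          exact ⟨_, rfl, .zero hm⟩
        | succ d =>
          obtain ⟨m, rfl, hm⟩ := ih₁ d (by simpa [runCheck] using h)
          exact ⟨m, rfl, hm⟩
      · obtain ⟨m, rfl, hm⟩ := ih₁ p (by simpa [runCheck] using h)
        simpa [List.replicate_succ] using RunConstrained.block p (p + 1) hp (by omega) hm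

theorem runConstrained_iff_runCheck {l : List Bool} :
    RunConstrained l ↔ runCheck l 0 0 = true := by
  refine ⟨RunConstrained.runCheck, fun h => ?_⟩
  obtain ⟨m, rfl, hm⟩ := (runConstrained_of_runCheck_aux l).1 0 h
  exact hm

instance : DecidablePred RunConstrained := fun _ =>
  decidable_of_iff _ runConstrained_iff_runCheck.symm

theorem hammingD_cons (x y : Bool) (a b : List Bool) :
    hammingD (x :: a) (y :: b) = (if x = y then 0 else 1) + hammingD a b := by
  cases x <;> cases y <;> simp [hammingD, Nat.add_comm]

theorem hammingD_self (a : List Bool) : hammingD a a = 0 := by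
  induction a with
  | nil => rfl
  | cons x a ih => simp [hammingD_cons, ih]

theorem hammingD_comm (a b : List Bool) : hammingD a b = hammingD b a := by
  simp only [hammingD]
  rw [List.zipWith_comm]
  simp only [bne_comm]

theorem hammingD_triangle {a b c : List Bool} (hab : a.length = b.length)
    (hbc : b.length = c.length) : hammingD a c ≤ hammingD a b + hammingD b c := by
  induction a generalizing b c with
  | nil => simp [hammingD]
  | cons x a ih =>
    obtain ⟨y, b, rfl⟩ := List.exists_cons_of_length_eq_add_one hab.symm
    obtain ⟨z, c, rfl⟩ := List.exists_cons_of_length_eq_add_one hbc.symm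
    have := @ih b c (by simpa using hab) (by simpa using hbc)
    simp only [hammingD_cons]
    grind

theorem eq_of_hammingD_eq_zero {a b : List Bool} (hab : a.length = b.length)
    (h : hammingD a b = 0) : a = b := by
  induction a generalizing b with
  | nil => simpa [eq_comm] using hab
  | cons x a ih =>
    obtain ⟨y, b, rfl⟩ := List.exists_cons_of_length_eq_add_one hab.symm
    have := @ih b (by simpa using hab)
    rw [hammingD_cons] at h
    grind

/-- All strings obtained from the given one by changing one coordinate. -/
def flips : List Bool → List (List Bool)
  | [] => []
  | x :: l => ((!x) :: l) :: (flips l).map (x :: ·)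

theorem mem_flips_of_hammingD_eq_one {a b : List Bool} (hab : a.length = b.length)
    (h : hammingD a b = 1) : b ∈ flips a := by
  induction a generalizing b with
  | nil => simp [hammingD] at h
  | cons x a ih =>
    obtain ⟨y, b, rfl⟩ := List.exists_cons_of_length_eq_add_one hab.symm
    have hab' : a.length = b.length := by simpa using hab
    rw [hammingD_cons] at h
    by_cases hxy : x = y
    · subst hxy
      simp [flips, ih hab' (by simpa using h)]
    · have hb : a = b := eq_of_hammingD_eq_zero hab' (by simpa [hxy] using h)
      have hy : y = !x := Bool.eq_not.mpr (Ne.symm hxy)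
      simp [flips, hb, hy]

theorem fibRunGraph_adj {n : ℕ}
    {a b : {l : List Bool // l.length = n ∧ RunConstrained (l ++ [false, false])}} :
    (fibRunGraph n).Adj a b ↔ hammingD a.1 b.1 = 1 := by
  simp only [fibRunGraph, SimpleGraph.fromRel_adj, hammingD_comm b.1 a.1, or_self,
    and_iff_right_iff_imp]
  rintro h rfl
  simp [hammingD_self] at h

theorem hammingD_le_walk_length {n : ℕ}
    {a b : {l : List Bool // l.length = n ∧ RunConstrained (l ++ [false, false])}}
    (p : (fibRunGraph n).Walk a b) : hammingD a.1 b.1 ≤ p.length := by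
  induction p with
  | nil => simp [hammingD_self]
  | @cons u v w h p ih =>
    have := hammingD_triangle (u.2.1.trans v.2.1.symm) (v.2.1.trans w.2.1.symm)
    rw [fibRunGraph_adj] at h
    rw [SimpleGraph.Walk.length_cons]
    omega

/-- If `S` labels strings with lower bounds such that every valid neighbour of a labelled string
either is too far from `b` or has a label exceeding the former one by at most one, then a walk from
a string labelled `k` to `b` has length at least `D - k`. -/
theorem le_add_walk_length {n D : ℕ} (S : List (List Bool × ℕ))
    {a b : {l : List Bool // l.length = n ∧ RunConstrained (l ++ [false, false])}}
    (hb : ∀ x ∈ S, x.1 ≠ b.1)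
    (hS : ∀ x ∈ S, ∀ w ∈ flips x.1, RunConstrained (w ++ [false, false]) →
      D ≤ x.2 + 1 + hammingD w b.1 ∨ ∃ y ∈ S, y.1 = w ∧ y.2 ≤ x.2 + 1)
    (p : (fibRunGraph n).Walk a b) {k : ℕ} (ha : (a.1, k) ∈ S) : D ≤ k + p.length := by
  induction p generalizing k with
  | nil => exact absurd rfl (hb _ ha)
  | @cons u v w h p ih =>
    have hv := mem_flips_of_hammingD_eq_one (u.2.1.trans v.2.1.symm) (fibRunGraph_adj.mp h)
    rw [SimpleGraph.Walk.length_cons]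
    rcases hS _ ha _ hv v.2.2 with hD | ⟨⟨y, j⟩, hy, rfl, hj⟩
    · have := hammingD_le_walk_length p
      dsimp only at hD
      omega
    · have := ih hb hS hy
      dsimp only at hj
      omega

/-- Changing successively the coordinates listed in `L` leads from `a` to `b` through vertices of
the Fibonacci-run graph. -/
def IsFlipPath (a b : List Bool) : List ℕ → Prop
  | [] => a = b
  | i :: L => RunConstrained (a.modify i not ++ [false, false]) ∧
      hammingD a (a.modify i not) = 1 ∧ IsFlipPath (a.modify i not) b L

instance decidableIsFlipPath (a b : List Bool) : ∀ L, Decidable (IsFlipPath a b L)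
  | [] => inferInstanceAs (Decidable (a = b))
  | i :: L =>
    have := decidableIsFlipPath (a.modify i not) b L
    inferInstanceAs (Decidable (_ ∧ _ ∧ _))

theorem IsFlipPath.exists_walk {n : ℕ} {L : List ℕ}
    {a b : {l : List Bool // l.length = n ∧ RunConstrained (l ++ [false, false])}}
    (h : IsFlipPath a.1 b.1 L) : ∃ p : (fibRunGraph n).Walk a b, p.length = L.length := by
  induction L generalizing a with
  | nil =>
    obtain rfl : a = b := Subtype.ext h
    exact ⟨.nil, rfl⟩
  | cons i L ih =>
    obtain ⟨hc, had, hL⟩ := h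
    obtain ⟨p, hp⟩ := @ih ⟨a.1.modify i not, by simpa using a.2.1, hc⟩ hL
    exact ⟨.cons (fibRunGraph_adj.mpr had) p, by simp [hp]⟩

theorem fibRunGraph_dist_eq_length {n : ℕ} {L : List ℕ} (S : List (List Bool × ℕ))
    {a b : {l : List Bool // l.length = n ∧ RunConstrained (l ++ [false, false])}}
    (hL : IsFlipPath a.1 b.1 L) (ha : (a.1, 0) ∈ S) (hb : ∀ x ∈ S, x.1 ≠ b.1)
    (hS : ∀ x ∈ S, ∀ w ∈ flips x.1, RunConstrained (w ++ [false, false]) →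
      L.length ≤ x.2 + 1 + hammingD w b.1 ∨ ∃ y ∈ S, y.1 = w ∧ y.2 ≤ x.2 + 1) :
    (fibRunGraph n).dist a b = L.length := by
  obtain ⟨p, hp⟩ := hL.exists_walk
  refine le_antisymm ((SimpleGraph.dist_le p).trans_eq hp) ?_
  obtain ⟨q, hq⟩ := p.reachable.exists_walk_length_eq_dist
  simpa [hq] using le_add_walk_length S hb hS q ha

/-- The string whose runs have the lengths listed, alternating between `x` and its negation and
starting with `x`. -/
def ofRuns : Bool → List ℕ → List Bool
  | _, [] => []
  | x, r :: L => List.replicate r x ++ ofRuns (!x) L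

/-- The strings that can be reached from `1¹¹0¹⁰` on a walk that might still arrive at
`100110001110000011100` in fewer than 14 steps, each with its distance from `1¹¹0¹⁰`. -/
def nearGeodesicLabels : List (List Bool × ℕ) :=
  [(ofRuns true [11, 10], 0),
    (ofRuns true [0, 1, 10, 10], 1),
    (ofRuns true [10, 11], 1),
    (ofRuns true [0, 2, 9, 10], 2),
    (ofRuns true [0, 1, 9, 11], 2),
    (ofRuns true [9, 12], 2),
    (ofRuns true [0, 3, 8, 10], 3),
    (ofRuns true [0, 2, 8, 11], 3),
    (ofRuns true [0, 2, 10, 9], 3),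
    (ofRuns true [1, 2, 8, 10], 4),
    (ofRuns true [0, 4, 7, 10], 4),
    (ofRuns true [0, 3, 7, 11], 4),
    (ofRuns true [0, 3, 9, 9], 4),
    (ofRuns true [0, 3, 8, 9, 1], 4),
    (ofRuns true [1, 3, 7, 10], 5),
    (ofRuns true [1, 2, 7, 11], 5),
    (ofRuns true [1, 2, 9, 9], 5),
    (ofRuns true [1, 2, 8, 9, 1], 5),
    (ofRuns true [0, 3, 7, 8, 1, 2], 5),
    (ofRuns true [1, 2, 7, 8, 1, 2], 6)]

theorem stmt_13 :
    ∃ (hβ : ([true, false, false, true, true, false, false, false, true, true, true,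
          false, false, false, false, false, true, true, true, false, false] :
            List Bool).length = 21 ∧
        RunConstrained ([true, false, false, true, true, false, false, false, true, true,
          true, false, false, false, false, false, true, true, true, false, false] ++
            [false, false]))
      (hγ : ([true, true, true, true, true, true, true, true, true, true, true, false,
          false, false, false, false, false, false, false, false, false] :
            List Bool).length = 21 ∧
        RunConstrained ([true, true, true, true, true, true, true, true, true, true, true,
          false, false, false, false, false, false, false, false, false, false] ++
            [false, false])),
      hammingD
        [true, false, false, true, true, false, false, false, true, true, true,
          false, false, false, false, false, true, true, true, false, false]
        [true, true, true, true, true, true, true, true, true, true, true, false,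
          false, false, false, false, false, false, false, false, false] = 8 ∧
      (fibRunGraph 21).dist
        ⟨[true, false, false, true, true, false, false, false, true, true, true,
          false, false, false, false, false, true, true, true, false, false], hβ⟩
        ⟨[true, true, true, true, true, true, true, true, true, true, true, false,
          false, false, false, false, false, false, false, false, false], hγ⟩ = 14 := by
  refine ⟨by decide +kernel, by decide +kernel, by decide +kernel, ?_⟩
  rw [SimpleGraph.dist_comm]
  exact fibRunGraph_dist_eq_length (L := [0, 1, 2, 0, 3, 4, 5, 3, 6, 7, 4, 16, 17, 18])
    nearGeodesicLabels (by decide +kernel) (by decide +kernel) (by decide +kernel)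
    (by decide +kernel)
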